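/- Let (X, μ) be a measure space, let σ_s : X → ℝ be measurable with σ_s ≥ 0 a.e., let d ∈ {2,3}, let ω_0, …, ω_L be unit vectors in ℝ^d, let w_0, …, w_L be positive quadrature weights, and let g : X × ℝ → ℝ be measurable with g(x,t) ≥ 0 for all x, t. Define m(x) = max_{0 ≤ l ≤ L} ∑_{i=0}^{L} w_i · g(x, ⟨ω_l, ω_i⟩). Let v^0,…,v^L and u^0,…,u^L be measurable functions on X such that m·σ_s·(v^l)² and m·σ_s·(u^l)² are integrable for each l. Then ∑_{l=0}^{L} w_l ∫_X σ_s(x) (∑_{i=0}^{L} w_i · g(x, ⟨ω_l, ω_i⟩) · v^i(x)) · u^l(x) dμ(x) ≤ (∑_{l=0}^{L} w_l ∫_X m(x) σ_s(x) (v^l(x))² dμ(x))^{1/2} · (∑_{l=0}^{L} w_l ∫_X m(x) σ_s(x) (u^l(x))² dμ(x))^{1/2}. -/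

import Mathlib

open MeasureTheory RealInnerProductSpace

/-- Schur test for a symmetric nonnegative kernel, in additive form. -/
lemma two_mul_sum_kernel_le {ι : Type*} [Fintype ι] {w : ι → ℝ} (hw : ∀ l, 0 ≤ w l)
    {G : ι → ι → ℝ} (hG : ∀ l i, 0 ≤ G l i) (hG_symm : ∀ l i, G l i = G i l)
    {M : ℝ} (hM : ∀ l, ∑ i, w i * G l i ≤ M) (a b : ι → ℝ) :
    2 * ∑ l, w l * ((∑ i, w i * G l i * a i) * b l) ≤
      ∑ l, w l * (M * a l ^ 2) + ∑ l, w l * (M * b l ^ 2) := by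
  have row_bound : ∀ c : ι → ℝ,
      ∑ l, ∑ i, w l * (w i * G l i) * c l ^ 2 ≤ ∑ l, w l * (M * c l ^ 2) := by
    intro c
    refine Finset.sum_le_sum fun l _ => ?_
    rw [← Finset.sum_mul, ← Finset.mul_sum, mul_assoc]
    exact mul_le_mul_of_nonneg_left
      (mul_le_mul_of_nonneg_right (hM l) (sq_nonneg _)) (hw l)
  have swap : ∑ l, ∑ i, w l * (w i * G l i) * a i ^ 2 =
      ∑ l, ∑ i, w l * (w i * G l i) * a l ^ 2 := by
    rw [Finset.sum_comm]
    refine Finset.sum_congr rfl fun l _ => Finset.sum_congr rfl fun i _ => ?_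
    rw [hG_symm i l]
    ring
  calc 2 * ∑ l, w l * ((∑ i, w i * G l i * a i) * b l)
      = ∑ l, ∑ i, w l * (w i * G l i) * (2 * a i * b l) := by
        simp only [Finset.sum_mul, Finset.mul_sum]
        refine Finset.sum_congr rfl fun l _ => Finset.sum_congr rfl fun i _ => ?_
        ring
    _ ≤ ∑ l, ∑ i, w l * (w i * G l i) * (a i ^ 2 + b l ^ 2) := by
        refine Finset.sum_le_sum fun l _ => Finset.sum_le_sum fun i _ => ?_
        exact mul_le_mul_of_nonneg_left (two_mul_le_add_sq _ _)
          (mul_nonneg (hw l) (mul_nonneg (hw i) (hG l i)))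
    _ = ∑ l, ∑ i, w l * (w i * G l i) * a l ^ 2 +
          ∑ l, ∑ i, w l * (w i * G l i) * b l ^ 2 := by
        rw [← swap]
        simp only [mul_add, Finset.sum_add_distrib]
    _ ≤ _ := add_le_add (row_bound a) (row_bound b)

/-- A product weighted by `k` is integrable when `k` is dominated by a weight for which both
factors are square integrable. -/
lemma integrable_weighted_mul {X : Type*} [MeasurableSpace X] {μ : Measure X}
    {k ρ f h : X → ℝ} (hk : Measurable k) (hf : Measurable f) (hh : Measurable h)
    (hkρ : ∀ᵐ x ∂μ, |k x| ≤ ρ x)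
    (hf_int : Integrable (fun x => ρ x * f x ^ 2) μ)
    (hh_int : Integrable (fun x => ρ x * h x ^ 2) μ) :
    Integrable (fun x => k x * f x * h x) μ := by
  refine (hf_int.add hh_int).mono' ((hk.mul hf).mul hh).aestronglyMeasurable ?_
  filter_upwards [hkρ] with x hx
  have hfh : |f x| * |h x| ≤ f x ^ 2 + h x ^ 2 := by
    nlinarith [sq_nonneg (|f x| - |h x|), sq_abs (f x), sq_abs (h x),
      sq_nonneg (f x), sq_nonneg (h x)]
  rw [Real.norm_eq_abs, abs_mul, abs_mul, mul_assoc, Pi.add_apply, ← mul_add]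
  exact mul_le_mul hx hfh (by positivity) ((abs_nonneg _).trans hx)

/-- Optimizing over the scaling parameter turns an additive bound into a product bound. -/
lemma le_rpow_half_mul_rpow_half {A B I : ℝ} (hA : 0 ≤ A) (hB : 0 ≤ B)
    (h : ∀ t : ℝ, 2 * (t * I) ≤ A + t ^ 2 * B) :
    I ≤ A ^ ((1 : ℝ) / 2) * B ^ ((1 : ℝ) / 2) := by
  rw [← Real.mul_rpow hA hB, ← Real.sqrt_eq_rpow]
  refine Real.le_sqrt_of_sq_le ?_
  have hd := discrim_le_zero (a := B) (b := -2 * I) (c := A) fun t => by nlinarith [h t]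
  rw [discrim] at hd
  nlinarith

theorem discrete_scattering_cauchy_schwarz
    {X : Type*} [MeasurableSpace X] (μ : Measure X)
    (σs : X → ℝ) (hσs_meas : Measurable σs) (hσs_nonneg : ∀ᵐ x ∂μ, 0 ≤ σs x)
    (d : ℕ) (hd : d = 2 ∨ d = 3) (L : ℕ)
    (ω : Fin (L + 1) → EuclideanSpace ℝ (Fin d)) (hω : ∀ l, ‖ω l‖ = 1)
    (w : Fin (L + 1) → ℝ) (hw : ∀ l, 0 < w l)
    (g : X → ℝ → ℝ) (hg_meas : Measurable (Function.uncurry g))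
    (hg_nonneg : ∀ x t, 0 ≤ g x t)
    (m : X → ℝ)
    (hm : ∀ x, m x = Finset.univ.sup' Finset.univ_nonempty
      (fun l : Fin (L + 1) => ∑ i, w i * g x ⟪ω l, ω i⟫))
    (v u : Fin (L + 1) → X → ℝ)
    (hv_meas : ∀ l, Measurable (v l)) (hu_meas : ∀ l, Measurable (u l))
    (hv_int : ∀ l, Integrable (fun x => m x * σs x * (v l x) ^ 2) μ)
    (hu_int : ∀ l, Integrable (fun x => m x * σs x * (u l x) ^ 2) μ) :
    ∑ l, w l * ∫ x, σs x * (∑ i, w i * g x ⟪ω l, ω i⟫ * v i x) * u l x ∂μ ≤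
      (∑ l, w l * ∫ x, m x * σs x * (v l x) ^ 2 ∂μ) ^ ((1 : ℝ) / 2) *
        (∑ l, w l * ∫ x, m x * σs x * (u l x) ^ 2 ∂μ) ^ ((1 : ℝ) / 2) := by
  have hG_symm : ∀ x l i, g x ⟪ω l, ω i⟫ = g x ⟪ω i, ω l⟫ := fun x l i => by
    rw [real_inner_comm]
  have row_le : ∀ x l, ∑ i, w i * g x ⟪ω l, ω i⟫ ≤ m x := fun x l => by
    rw [hm]
    exact Finset.le_sup' (fun l => ∑ i, w i * g x ⟪ω l, ω i⟫) (Finset.mem_univ l)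
  have entry_nonneg : ∀ x l i, 0 ≤ w i * g x ⟪ω l, ω i⟫ := fun x l i =>
    mul_nonneg (hw i).le (hg_nonneg _ _)
  have entry_le : ∀ x l i, w i * g x ⟪ω l, ω i⟫ ≤ m x := fun x l i =>
    (Finset.single_le_sum (f := fun i => w i * g x ⟪ω l, ω i⟫)
      (fun i _ => entry_nonneg x l i) (Finset.mem_univ i)).trans (row_le x l)
  have hm_nonneg : ∀ x, 0 ≤ m x := fun x => (entry_nonneg x 0 0).trans (entry_le x 0 0)
  have hg_slice : ∀ c : ℝ, Measurable fun x => g x c := fun c =>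
    hg_meas.comp (measurable_id.prodMk measurable_const)
  have hint : ∀ l, Integrable
      (fun x => σs x * (∑ i, w i * g x ⟪ω l, ω i⟫ * v i x) * u l x) μ := by
    intro l
    have hterm : ∀ i, Integrable
        (fun x => σs x * (w i * g x ⟪ω l, ω i⟫) * v i x * u l x) μ := by
      intro i
      refine integrable_weighted_mul (hσs_meas.mul ((hg_slice _).const_mul _))
        (hv_meas i) (hu_meas l) ?_ (hv_int i) (hu_int l)
      filter_upwards [hσs_nonneg] with x hx
      rw [abs_of_nonneg (mul_nonneg hx (entry_nonneg x l i)), mul_comm]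
      exact mul_le_mul_of_nonneg_right (entry_le x l i) hx
    refine (integrable_finsetSum Finset.univ fun i _ => hterm i).congr (.of_forall fun x => ?_)
    dsimp only
    rw [Finset.mul_sum, Finset.sum_mul]
    exact Finset.sum_congr rfl fun i _ => by ring
  have energy_nonneg : ∀ f : Fin (L + 1) → X → ℝ,
      0 ≤ ∑ l, w l * ∫ x, m x * σs x * (f l x) ^ 2 ∂μ := by
    refine fun f => Finset.sum_nonneg fun l _ => mul_nonneg (hw l).le ?_
    refine integral_nonneg_of_ae ?_
    filter_upwards [hσs_nonneg] with x hx
    exact mul_nonneg (mul_nonneg (hm_nonneg x) hx) (sq_nonneg _)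
  have sum_integral : ∀ F : Fin (L + 1) → X → ℝ, (∀ l, Integrable (F l) μ) →
      ∑ l, w l * ∫ x, F l x ∂μ = ∫ x, ∑ l, w l * F l x ∂μ := by
    intro F hF
    rw [integral_finsetSum _ fun l _ => (hF l).const_mul (w l)]
    simp only [integral_const_mul]
  have integrable_sum : ∀ F : Fin (L + 1) → X → ℝ, (∀ l, Integrable (F l) μ) →
      Integrable (fun x => ∑ l, w l * F l x) μ := fun F hF =>
    integrable_finsetSum _ fun l _ => (hF l).const_mul (w l)
  refine le_rpow_half_mul_rpow_half (energy_nonneg v) (energy_nonneg u) fun t => ?_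
  rw [sum_integral _ hint, sum_integral _ hv_int, sum_integral _ hu_int,
    ← integral_const_mul, ← integral_const_mul, ← integral_const_mul,
    ← integral_add (integrable_sum _ hv_int) ((integrable_sum _ hu_int).const_mul _)]
  refine integral_mono_ae (((integrable_sum _ hint).const_mul _).const_mul _)
    ((integrable_sum _ hv_int).add ((integrable_sum _ hu_int).const_mul _)) ?_
  filter_upwards [hσs_nonneg] with x hx
  have key := mul_le_mul_of_nonneg_left
    (two_mul_sum_kernel_le (fun l => (hw l).le) (fun l i => hg_nonneg x ⟪ω l, ω i⟫)
      (hG_symm x) (row_le x) (fun l => v l x) (fun l => t * u l x)) hx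
  convert key using 1
  · simp only [Finset.mul_sum, Finset.sum_mul]
    exact Finset.sum_congr rfl fun l _ => Finset.sum_congr rfl fun i _ => by ring
  · simp only [mul_add, Finset.mul_sum]
    congr 1 <;> exact Finset.sum_congr rfl fun l _ => by ring
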